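/- In the discrete processor model (the system q̇_{i,k} = F_{i,k-1} − F_{i,k} with throughput F_{i,k} = a_i v1(v2(q_{i,k}, Q_{i+1,k} − Q_{i,k} + q_{i,k}, Q_{i−1,k} − Q_{i,k} + q_{i,k}; β); q*), indices periodic in i, a_i ≥ 0, q* > 0, β ∈ (0,1], and prescribed continuous inflow q_{i,0}), if the initial data satisfy q_{i,k}(0) ≥ 0 for all i = 1,…,imax and k = 1,…,kmax, then the unique solution satisfies q_{i,k}(t) ≥ 0 for all t ≥ 0 and all i, k. -/

import Mathlib

/-- Self-throttling function `v1(q; q*) = max{0, min{1, q/q*}}`. -/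
noncomputable def v1 (q qstar : ℝ) : ℝ := max 0 (min 1 (q / qstar))

/-- Neighbor-throttling function
`v2(q, Δ⁺, Δ⁻; β) = min{q, (1/β)·max{Δ⁺, 0}, (1/β)·max{Δ⁻, 0}}`. -/
noncomputable def v2 (q Δp Δm β : ℝ) : ℝ :=
  min q (min ((1 / β) * max Δp 0) ((1 / β) * max Δm 0))

/-- `Q_{i,k}(t) = ∑_{j=k}^{kmax} q_{i,j}(t) + ∫₀ᵗ F_{i,kmax}(s) ds`, expressed in terms of the
current state `(q, J)` where `J_i(t) = ∫₀ᵗ F_{i,kmax}(s) ds` is the accumulated outflow; the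
stage index `k` is 1-based (stage `j` corresponds to the 0-based index `j − 1`). -/
noncomputable def Qfun {imax kmax : ℕ} (q : Fin imax → Fin kmax → ℝ) (J : Fin imax → ℝ)
    (i : Fin imax) (k : ℕ) : ℝ :=
  (∑ j ∈ Finset.Ico (k - 1) kmax, (if h : j < kmax then q i ⟨j, h⟩ else 0)) + J i

/-- The amount of data sitting at (1-based) stage `k` of processor `i`: for `k = 0` it is the
prescribed inflow datum `q_{i,0}`, and for `1 ≤ k ≤ kmax` it is the state `q_{i,k}`. -/
noncomputable def dataAt {imax kmax : ℕ} (qin : Fin imax → ℝ)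
    (q : Fin imax → Fin kmax → ℝ) (i : Fin imax) (k : ℕ) : ℝ :=
  if k = 0 then qin i else if h : k - 1 < kmax then q i ⟨k - 1, h⟩ else 0

/-- The throughput
`F_{i,k} = a_i · v1(v2(q_{i,k}, Q_{i+1,k} − Q_{i,k} + q_{i,k}, Q_{i−1,k} − Q_{i,k} + q_{i,k}; β); q*)`,
with the processor indices `i ± 1` taken modulo `imax`. -/
noncomputable def Ffun {imax kmax : ℕ} [NeZero imax] (a : Fin imax → ℝ) (qstar β : ℝ)
    (qin : Fin imax → ℝ) (q : Fin imax → Fin kmax → ℝ) (J : Fin imax → ℝ)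
    (i : Fin imax) (k : ℕ) : ℝ :=
  a i * v1 (v2 (dataAt qin q i k)
      (Qfun q J (i + 1) k - Qfun q J i k + dataAt qin q i k)
      (Qfun q J (i - 1) k - Qfun q J i k + dataAt qin q i k) β) qstar

/-- `(q, J)` is a solution of the discrete processor model
`q̇_{i,k} = F_{i,k−1} − F_{i,k}` (`k = 1, …, kmax`), together with the accumulated outflow
`J̇_i = F_{i,kmax}`, `J_i(0) = 0`, on `[0, ∞)`, with initial data `q(0) = qinit` and
prescribed inflow `qin`.  The 0-based index `k : Fin kmax` represents the 1-based stage
`k + 1`. -/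
def IsSol {imax kmax : ℕ} [NeZero imax] (a : Fin imax → ℝ) (qstar β : ℝ)
    (qin : Fin imax → ℝ → ℝ) (qinit : Fin imax → Fin kmax → ℝ)
    (q : ℝ → Fin imax → Fin kmax → ℝ) (J : ℝ → Fin imax → ℝ) : Prop :=
  q 0 = qinit ∧ J 0 = 0 ∧
  (∀ t : ℝ, 0 ≤ t → ∀ i : Fin imax, ∀ k : Fin kmax,
    HasDerivWithinAt (fun s => q s i k)
      (Ffun a qstar β (fun j => qin j t) (q t) (J t) i k.val
        - Ffun a qstar β (fun j => qin j t) (q t) (J t) i (k.val + 1))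
      (Set.Ici 0) t) ∧
  (∀ t : ℝ, 0 ≤ t → ∀ i : Fin imax,
    HasDerivWithinAt (fun s => J s i)
      (Ffun a qstar β (fun j => qin j t) (q t) (J t) i kmax) (Set.Ici 0) t)

/-- A function on `[0, ∞)` that starts nonnegative and is nondecreasing to first order wherever it
is negative stays nonnegative. -/
theorem nonneg_of_deriv_nonneg_of_neg {f f' : ℝ → ℝ}
    (hf : ∀ t, 0 ≤ t → HasDerivWithinAt f (f' t) (Set.Ici 0) t) (h0 : 0 ≤ f 0)
    (hneg : ∀ t, 0 ≤ t → f t < 0 → 0 ≤ f' t) {t : ℝ} (ht : 0 ≤ t) : 0 ≤ f t := by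
  have key : ∀ ε : ℝ, 0 < ε → -f t ≤ ε * (1 + t) := by
    intro ε hε
    refine image_le_of_deriv_right_lt_deriv_boundary (f := fun s => -f s) (f' := fun s => -f' s)
      (a := 0) (b := t) (B := fun s => ε * (1 + s)) (B' := fun _ => ε) ?_ ?_ ?_ ?_ ?_
      (Set.right_mem_Icc.2 ht)
    · exact fun s hs => ((hf s hs.1).continuousWithinAt.mono Set.Icc_subset_Ici_self).neg
    · exact fun s hs => ((hf s hs.1).mono (Set.Ici_subset_Ici.2 hs.1)).neg
    · simp only [add_zero, mul_one]
      linarith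
    · intro s
      simpa using ((hasDerivAt_id s).const_add 1).const_mul ε
    · intro s hs hfs
      have hpos : 0 < ε * (1 + s) := mul_pos hε (by linarith [hs.1])
      have := hneg s hs.1 (by linarith)
      linarith
  by_contra! hlt
  have h1 : 0 < 1 + t := by linarith
  have h2 := key (-f t / (2 * (1 + t))) (div_pos (by linarith) (by linarith))
  have h3 : -f t / (2 * (1 + t)) * (1 + t) = -f t / 2 := by field_simp
  linarith

theorem v1_nonneg (q qstar : ℝ) : 0 ≤ v1 q qstar := le_max_left _ _

theorem v1_eq_zero_of_nonpos {q qstar : ℝ} (hqstar : 0 < qstar) (hq : q ≤ 0) :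
    v1 q qstar = 0 :=
  max_eq_left ((min_le_right _ _).trans (div_nonpos_of_nonpos_of_nonneg hq hqstar.le))

theorem v2_le_self (q Δp Δm β : ℝ) : v2 q Δp Δm β ≤ q := min_le_left _ _

theorem Ffun_nonneg {imax kmax : ℕ} [NeZero imax] {a : Fin imax → ℝ} (ha : ∀ i, 0 ≤ a i)
    (qstar β : ℝ) (qin : Fin imax → ℝ) (q : Fin imax → Fin kmax → ℝ) (J : Fin imax → ℝ)
    (i : Fin imax) (k : ℕ) : 0 ≤ Ffun a qstar β qin q J i k :=
  mul_nonneg (ha i) (v1_nonneg _ _)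

theorem Ffun_eq_zero_of_dataAt_nonpos {imax kmax : ℕ} [NeZero imax] (a : Fin imax → ℝ)
    {qstar : ℝ} (hqstar : 0 < qstar) (β : ℝ) {qin : Fin imax → ℝ}
    {q : Fin imax → Fin kmax → ℝ} (J : Fin imax → ℝ) {i : Fin imax} {k : ℕ}
    (h : dataAt qin q i k ≤ 0) : Ffun a qstar β qin q J i k = 0 := by
  rw [Ffun, v1_eq_zero_of_nonpos hqstar ((v2_le_self _ _ _ _).trans h), mul_zero]

theorem dataAt_succ {imax kmax : ℕ} (qin : Fin imax → ℝ) (q : Fin imax → Fin kmax → ℝ)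
    (i : Fin imax) (k : Fin kmax) : dataAt qin q i (k.val + 1) = q i k := by
  simp [dataAt]

/-- In the discrete processor model (`q̇_{i,k} = F_{i,k−1} − F_{i,k}` with
throughput `F_{i,k} = a_i v1(v2(q_{i,k}, Q_{i+1,k} − Q_{i,k} + q_{i,k},
Q_{i−1,k} − Q_{i,k} + q_{i,k}; β); q*)`, indices periodic in `i`, `a_i ≥ 0`, `q* > 0`,
`β ∈ (0,1]`, and prescribed continuous inflow), if the initial data satisfy
`q_{i,k}(0) ≥ 0` for all `i, k`, then the solution satisfies `q_{i,k}(t) ≥ 0` for all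
`t ≥ 0` and all `i, k`. -/
theorem stmt1 {imax kmax : ℕ} [NeZero imax] (hkmax : 1 ≤ kmax)
    (a : Fin imax → ℝ) (ha : ∀ i, 0 ≤ a i)
    (qstar : ℝ) (hqstar : 0 < qstar) (β : ℝ) (hβ : β ∈ Set.Ioc (0:ℝ) 1)
    (qin : Fin imax → ℝ → ℝ) (hqin : ∀ i, Continuous (qin i))
    (qinit : Fin imax → Fin kmax → ℝ) (hinit : ∀ i k, 0 ≤ qinit i k) :
    ∀ q J, IsSol a qstar β qin qinit q J →
      ∀ t : ℝ, 0 ≤ t → ∀ i k, 0 ≤ q t i k := by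
  rintro q J ⟨hq0, -, hq, -⟩ t ht i k
  refine nonneg_of_deriv_nonneg_of_neg (fun s hs => hq s hs i k) ?_ ?_ ht
  · rw [hq0]
    exact hinit i k
  · intro s _ hneg
    rw [Ffun_eq_zero_of_dataAt_nonpos a hqstar β (J s) (k := k.val + 1)
      ((dataAt_succ _ _ i k).trans_le hneg.le), sub_zero]
    exact Ffun_nonneg ha _ _ _ _ _ _ _
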